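/- Let n ≥ 1, k ≤ N − 1, and let C 1, …, C n be submodules of V = Fin (N+1) → ℂ with finrank (C i) = 1 for all i (point centers in ℙ^N). Then the arrangement (C i) is pseudo-disjoint with respect to k if and only if either the C i are pairwise distinct (equivalently C i ⊓ C j = ⊥ for all i ≠ j) or k = N − 1. (Paper's specialization of pseudo-disjointedness to point centers: pseudo-disjointedness is equivalent to the arrangement being disjoint or k = N − 1.) -/

import Mathlib

open Module

/-- A center arrangement `C` in `ℙ^N` is *pseudo-disjoint with respect to `k`*. -/
def IsPseudoDisjoint (N k n : ℕ) (C : Fin n → Submodule ℂ (Fin (N + 1) → ℂ)) : Prop :=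
  ∀ H : Fin n → Submodule ℂ (Fin (N + 1) → ℂ),
    (∀ i, C i ≤ H i ∧ finrank ℂ ↥(H i) = finrank ℂ ↥(C i) + k + 1) →
    finrank ℂ ↥(⨅ i, H i) ≥ k + 1 →
    ∀ I : Finset (Fin n), 2 ≤ I.card → (⨅ i ∈ I, C i) ≠ ⊥ →
      finrank ℂ ↥(⨅ i ∈ I, H i) ≥ finrank ℂ ↥(⨅ i ∈ I, C i) + k + 1

/-- A subspace can be enlarged to any dimension between its own and that of the whole space. -/
theorem Submodule.exists_ge_finrank_eq {K V : Type*} [Field K] [AddCommGroup V]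
    [Module K V] [FiniteDimensional K V] (W : Submodule K V) {m : ℕ}
    (hWm : finrank K ↥W ≤ m) (hm : m ≤ finrank K V) :
    ∃ U : Submodule K V, W ≤ U ∧ finrank K ↥U = m := by
  induction m, hWm using Nat.le_induction with
  | base => exact ⟨W, le_rfl, rfl⟩
  | succ m _ ih =>
    obtain ⟨U, hWU, hU⟩ := ih (by omega)
    obtain ⟨v, -, hv⟩ := SetLike.exists_of_lt (Submodule.lt_top_of_finrank_lt_finrank
      (show finrank K ↥U < finrank K V by omega))
    exact ⟨U ⊔ K ∙ v, hWU.trans le_sup_left, by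
      rw [Submodule.finrank_sup_span_singleton hv, hU]⟩

/-- **Paper's specialization of pseudo-disjointedness to point centers**: for point
centers (`finrank (C i) = 1`) and `k ≤ N − 1`, the arrangement is pseudo-disjoint
with respect to `k` iff either the centers are pairwise disjoint or `k = N − 1`. -/
theorem pseudo_disjoint_point_centers (N k n : ℕ) (hk : k ≤ N - 1) (hn : 1 ≤ n)
    (C : Fin n → Submodule ℂ (Fin (N + 1) → ℂ))
    (hC : ∀ i, finrank ℂ ↥(C i) = 1) :
    IsPseudoDisjoint N k n C ↔
      ((∀ i j, i ≠ j → C i ⊓ C j = ⊥) ∨ k = N - 1) := by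
  have hV : finrank ℂ (Fin (N + 1) → ℂ) = N + 1 := by simp
  constructor
  · intro hpd
    by_contra! hcon
    obtain ⟨⟨i, j, hij, hCij⟩, hkN⟩ := hcon
    -- The two centers coincide, being lines with nonzero intersection.
    have hpos := Submodule.one_le_finrank_iff.mpr hCij
    have hi : C i ⊓ C j = C i :=
      Submodule.eq_of_le_of_finrank_le inf_le_left (by rw [hC i]; exact hpos)
    have hj : C i ⊓ C j = C j :=
      Submodule.eq_of_le_of_finrank_le inf_le_right (by rw [hC j]; exact hpos)
    have hCeq : C j = C i := hj.symm.trans hi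
    obtain ⟨W, hCW, hW⟩ := (C i).exists_ge_finrank_eq (m := k + 1) (by rw [hC i]; omega) (by omega)
    have hex : ∀ l, ∃ U, W ⊔ C l ≤ U ∧ finrank ℂ ↥U = k + 2 := fun l =>
      (W ⊔ C l).exists_ge_finrank_eq
        (by have := Submodule.finrank_add_le_finrank_add_finrank W (C l); rw [hC l] at this; omega)
        (by omega)
    choose G hG hGrank using hex
    obtain ⟨b, -, hb⟩ := SetLike.exists_of_lt (Submodule.lt_top_of_finrank_lt_finrank
      (show finrank ℂ ↥(G i) < finrank ℂ (Fin (N + 1) → ℂ) by rw [hGrank i]; omega))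
    have hbW : b ∉ W := fun h => hb (hG i (le_sup_left (b := C i) h))
    set H := Function.update G j (W ⊔ ℂ ∙ b) with hH
    have hHi : H i = G i := Function.update_of_ne hij _ _
    have hHj : H j = W ⊔ ℂ ∙ b := Function.update_self _ _ _
    have hHl : ∀ l, W ⊔ C l ≤ H l ∧ finrank ℂ ↥(H l) = k + 2 := by
      intro l
      by_cases hl : l = j
      · subst hl
        rw [hHj, hCeq, Submodule.finrank_sup_span_singleton hbW, hW]
        exact ⟨sup_le le_sup_left (hCW.trans le_sup_left), rfl⟩
      · rw [hH, Function.update_of_ne hl]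
        exact ⟨hG l, hGrank l⟩
    have hCI : (⨅ l ∈ ({i, j} : Finset (Fin n)), C l) = C i := by
      rw [Finset.iInf_insert, Finset.iInf_singleton, hi]
    have hHI : (⨅ l ∈ ({i, j} : Finset (Fin n)), H l) = H i ⊓ H j := by
      rw [Finset.iInf_insert, Finset.iInf_singleton]
    have key := hpd H
      (fun l => ⟨le_sup_right.trans (hHl l).1, by rw [(hHl l).2, hC l]; omega⟩)
      (hW ▸ Submodule.finrank_mono (le_iInf fun l => le_sup_left.trans (hHl l).1))
      {i, j} (Finset.card_pair hij).ge
      (by rw [hCI]; exact Submodule.one_le_finrank_iff.mp (hC i).ge)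
    rw [hCI, hHI, hC i] at key
    have hle : H j ≤ H i := inf_eq_right.mp
      (Submodule.eq_of_le_of_finrank_le inf_le_right (by rw [(hHl j).2]; omega))
    rw [hHi, hHj] at hle
    exact hb (hle (le_sup_right (a := W) (Submodule.mem_span_singleton_self b)))
  · rintro (hdisj | rfl) H hH _ I hI hne
    · obtain ⟨i, hi, j, hj, hij⟩ := Finset.one_lt_card.mp hI
      exact absurd (le_bot_iff.mp
        ((le_inf (iInf₂_le i hi) (iInf₂_le j hj)).trans (hdisj i j hij).le)) hne
    · have htop : ∀ i, H i = ⊤ := fun i =>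
        Submodule.eq_top_of_finrank_eq (le_antisymm (Submodule.finrank_le _)
          (by rw [(hH i).2, hC i, hV]; omega))
      have hN : N - 1 + 2 ≤ N + 1 := by
        have h := Submodule.finrank_le (H ⟨0, hn⟩)
        rw [(hH _).2, hC, hV] at h
        omega
      obtain ⟨i, hi⟩ := Finset.card_pos.mp (by omega : 0 < I.card)
      have hle : finrank ℂ ↥(⨅ i ∈ I, C i) ≤ 1 :=
        (Submodule.finrank_mono (iInf₂_le i hi)).trans (hC i).le
      have hHI : (⨅ i ∈ I, H i) = ⊤ := by simp [htop]
      rw [hHI, finrank_top, hV]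
      omega
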